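/- arXiv:2510.05546 — 2 statements merged into one kernel-verified Lean document; each statement's English description precedes it below -/
import Mathlib

section
/- Fix n ≥ 1 and real numbers α, β with n*α + β = 0. For z : Fin n → ℂ with z ≠ 0, define R z i j k l := δ_{ij} * δ_{kl} − (conj (z i) * z j / ‖z‖²) * δ_{kl}, where ‖z‖² := ∑_m z m * conj (z m), and Ric i j := ∑_m R z i j m m. Then for every z ≠ 0 and every X : Fin n → ℂ: (α:ℂ) * (∑_{i,j} Ric i j * X i * conj (X j)) * ‖X‖² + (β:ℂ) * (∑_{i,j,k,l} R z i j k l * X i * conj (X j) * X k * conj (X l)) = 0. -/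
open ComplexConjugate

/-- Kronecker delta. -/
noncomputable def kdelta {n : ℕ} (i j : Fin n) : ℂ := if i = j then 1 else 0

/-- `‖z‖² = ∑ₘ zₘ conj(zₘ)` as a complex number. -/
noncomputable def normSqC {n : ℕ} (X : Fin n → ℂ) : ℂ := ∑ m, X m * conj (X m)

/-- The Chern curvature tensor of the standard Hopf metric in the unitary frame
`eᵢ = |z| ∂/∂zᵢ`:  `R_{i j̄ k l̄} = δ_{ij} δ_{kl} − (z̄ᵢ zⱼ/|z|²) δ_{kl}`. -/
noncomputable def hopfR {n : ℕ} (z : Fin n → ℂ) (i j k l : Fin n) : ℂ :=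
  kdelta i j * kdelta k l - (conj (z i) * z j / normSqC z) * kdelta k l

/-- First Chern Ricci trace of the Hopf curvature tensor. -/
noncomputable def hopfRic {n : ℕ} (z : Fin n → ℂ) (i j : Fin n) : ℂ :=
  ∑ m, hopfR z i j m m

/-- The curvature tensor is a form in the first two slots times `δ` in the last two. -/
lemma hopfR_eq_mul_kdelta {n : ℕ} (z : Fin n → ℂ) (i j k l : Fin n) :
    hopfR z i j k l = (kdelta i j - conj (z i) * z j / normSqC z) * kdelta k l := by
  rw [hopfR, sub_mul]

lemma hopfRic_eq {n : ℕ} (z : Fin n → ℂ) (i j : Fin n) :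
    hopfRic z i j = n * (kdelta i j - conj (z i) * z j / normSqC z) := by
  simp only [hopfRic, hopfR_eq_mul_kdelta, ← Finset.mul_sum]
  simp [kdelta.eq_def _ _, mul_comm]

lemma sum_hopfR_mul {n : ℕ} (z X : Fin n → ℂ) (i j : Fin n) :
    ∑ k, ∑ l, hopfR z i j k l * X i * conj (X j) * X k * conj (X l) =
      (kdelta i j - conj (z i) * z j / normSqC z) * X i * conj (X j) * normSqC X := by
  have h : ∀ k, ∑ l, hopfR z i j k l * X i * conj (X j) * X k * conj (X l) =
      (kdelta i j - conj (z i) * z j / normSqC z) * X i * conj (X j) * (X k * conj (X k)) := by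
    intro k
    rw [Finset.sum_eq_single k]
    · rw [hopfR_eq_mul_kdelta, kdelta.eq_def k k, if_pos rfl]
      ring
    · intro l _ hl
      rw [hopfR_eq_mul_kdelta, kdelta.eq_def k l, if_neg hl.symm]
      ring
    · simp
  simp only [h, ← Finset.mul_sum, normSqC]

/-- The isosceles Hopf manifold satisfies `C^{(1)}_{α,β} = 0` when `nα + β = 0`. -/
theorem hopf_mixed_curvature_vanishes (n : ℕ) (hn : 1 ≤ n) (α β : ℝ)
    (hab : (n : ℝ) * α + β = 0) :
    ∀ z : Fin n → ℂ, z ≠ 0 → ∀ X : Fin n → ℂ,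
      (α : ℂ) * (∑ i, ∑ j, hopfRic z i j * X i * conj (X j)) * normSqC X
        + (β : ℂ) * (∑ i, ∑ j, ∑ k, ∑ l,
            hopfR z i j k l * X i * conj (X j) * X k * conj (X l)) = 0 := by
  intro z _ X
  have hab' : (n : ℂ) * α + β = 0 := by exact_mod_cast hab
  simp only [hopfRic_eq, sum_hopfR_mul, mul_assoc (n : ℂ), ← Finset.mul_sum, ← Finset.sum_mul]
  linear_combination (∑ i, ∑ j, (kdelta i j - conj (z i) * z j / normSqC z) * X i *
    conj (X j)) * normSqC X * hab'
end

section
/- Fix n ≥ 1 and, for z : Fin n → ℂ with z ≠ 0, define the Hopf curvature tensor R z i j k l := δ_{ij} * δ_{kl} − (conj (z i) * z j / ‖z‖²) * δ_{kl}, where ‖z‖² := ∑_m z m * conj (z m). Then for every z ≠ 0: (i) the first Ricci trace satisfies ∑_m R z i j m m = n * δ_{ij} − n * conj (z i) * z j / ‖z‖² for all i, j; (ii) the second Ricci trace satisfies ∑_i R z i i k l = (n − 1) * δ_{kl} for all k, l; (iii) the scalar curvature u := ∑_{i,k} R z i i k k equals n² − n; and (iv) the altered scalar curvature v := ∑_{i,k}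 R z i k k i equals n − 1. -/
open ComplexConjugate

theorem kdelta_self {n : ℕ} (i : Fin n) : kdelta i i = 1 := if_pos rfl

theorem sum_mul_kdelta {n : ℕ} (f : Fin n → ℂ) (i : Fin n) :
    ∑ k, f k * kdelta k i = f i := by
  simp [kdelta]

theorem normSqC_ne_zero {n : ℕ} {z : Fin n → ℂ} (hz : z ≠ 0) : normSqC z ≠ 0 := by
  have hcast : normSqC z = ((∑ m, Complex.normSq (z m) : ℝ) : ℂ) := by
    simp [normSqC, Complex.mul_conj]
  obtain ⟨i, hi⟩ := Function.ne_iff.mp hz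
  rw [hcast, Complex.ofReal_ne_zero]
  exact (Finset.sum_pos' (fun m _ => Complex.normSq_nonneg (z m))
    ⟨i, Finset.mem_univ i, Complex.normSq_pos.mpr hi⟩).ne'

theorem sum_conj_mul_div_normSqC {n : ℕ} {z : Fin n → ℂ} (hz : z ≠ 0) :
    ∑ i, conj (z i) * z i / normSqC z = 1 := by
  rw [← Finset.sum_div, div_eq_one_iff_eq (normSqC_ne_zero hz)]
  exact Finset.sum_congr rfl fun i _ => mul_comm _ _

theorem sum_hopfR_self_left {n : ℕ} {z : Fin n → ℂ} (hz : z ≠ 0) (k l : Fin n) :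
    ∑ i, hopfR z i i k l = ((n : ℂ) - 1) * kdelta k l := by
  simp only [hopfR, kdelta_self, ← sub_mul]
  rw [← Finset.sum_mul, Finset.sum_sub_distrib, sum_conj_mul_div_normSqC hz]
  simp

/-- Equations (2.7), (2.8) and the scalar curvature computations for the Hopf metric. -/
theorem hopf_ricci_and_scalar (n : ℕ) (hn : 1 ≤ n) :
    ∀ z : Fin n → ℂ, z ≠ 0 →
      (∀ i j : Fin n, ∑ m, hopfR z i j m m
          = (n : ℂ) * kdelta i j - (n : ℂ) * conj (z i) * z j / normSqC z)
      ∧ (∀ k l : Fin n, ∑ i, hopfR z i i k l = ((n : ℂ) - 1) * kdelta k l)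
      ∧ (∑ i, ∑ k, hopfR z i i k k = (n : ℂ) ^ 2 - (n : ℂ))
      ∧ (∑ i, ∑ k, hopfR z i k k i = (n : ℂ) - 1) := by
  intro z hz
  refine ⟨fun i j => ?_, sum_hopfR_self_left hz, ?_, ?_⟩
  · simp only [hopfR, kdelta_self, Finset.sum_const, Finset.card_univ, Fintype.card_fin,
      nsmul_eq_mul]
    ring
  · rw [Finset.sum_comm]
    simp only [sum_hopfR_self_left hz, kdelta_self, Finset.sum_const, Finset.card_univ,
      Fintype.card_fin, nsmul_eq_mul]
    ring
  · simp only [hopfR, Finset.sum_sub_distrib, sum_mul_kdelta, kdelta_self,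
      sum_conj_mul_div_normSqC hz]
    simp
end
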